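/- arXiv:math/0211453 — 6 statements merged into one kernel-verified Lean document; each statement's English description precedes it below -/
import Mathlib

section
/- Let H be a real Hilbert space and let S, A : H →L[ℝ] H be bounded linear operators such that S is self-adjoint (S† = S) and A is skew-adjoint (A† = -A). Then the operator T = 1 + S + A satisfies ‖T‖² ≤ 1 + 2‖S‖ + (‖S‖ + ‖A‖)². -/
/-- For bounded operators on a real Hilbert space with `S` self-adjoint and `A`
skew-adjoint, the operator `T = 1 + S + A` satisfies
`‖T‖² ≤ 1 + 2‖S‖ + (‖S‖ + ‖A‖)²`. -/
theorem stmt_0 {H : Type*} [NormedAddCommGroup H] [InnerProductSpace ℝ H] [CompleteSpace H]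
    (S A : H →L[ℝ] H)
    (hS : ContinuousLinearMap.adjoint S = S)
    (hA : ContinuousLinearMap.adjoint A = -A) :
    ‖(1 + S + A : H →L[ℝ] H)‖ ^ 2 ≤ 1 + 2 * ‖S‖ + (‖S‖ + ‖A‖) ^ 2 := by
  have h_star : star (1 + S + A) * (1 + S + A) = 1 + (S + S) + (S - A) * (S + A) := by
    rw [star_add, star_add, star_one, ContinuousLinearMap.star_eq_adjoint,
      ContinuousLinearMap.star_eq_adjoint, hS, hA]
    noncomm_ring
  calc ‖1 + S + A‖ ^ 2 = ‖1 + (S + S) + (S - A) * (S + A)‖ := by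
        rw [← h_star, sq]
        exact (ContinuousLinearMap.norm_adjoint_comp_self (1 + S + A)).symm
    _ ≤ ‖(1 : H →L[ℝ] H)‖ + ‖S + S‖ + ‖(S - A) * (S + A)‖ := norm_add₃_le
    _ ≤ 1 + (‖S‖ + ‖S‖) + (‖S‖ + ‖A‖) * (‖S‖ + ‖A‖) := by
        gcongr
        · exact ContinuousLinearMap.norm_id_le
        · exact norm_add_le S S
        · exact (norm_mul_le _ _).trans
            (mul_le_mul (norm_sub_le S A) (norm_add_le S A) (norm_nonneg _) (by positivity))
    _ = 1 + 2 * ‖S‖ + (‖S‖ + ‖A‖) ^ 2 := by ring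
end

section
/- Let g, τ, h be real numbers with τ > 0 and h > 0, let θ : ℤ → ℝ be a sequence, and let K ≥ 0 be such that |θ_{i+1} − θ_i| ≤ K·h and |θ_{i+1} − θ_{i−1}| ≤ 2K·h for all i ∈ ℤ. Then the linear operator S on ℓ²(ℤ, ℝ) defined by (S v)_i = −(gτ/(4h))·[(θ_i − θ_{i+1}) v_{i+1} − (θ_i − θ_{i−1}) v_{i−1} + 2(θ_{i+1} − θ_{i−1}) v_i] is a bounded self-adjoint operator and its operator norm satisfies ‖S‖ ≤ (3/2)·|g|·τ·K. -/
theorem memlp_two_iff_summable_sq {ι : Type*} {f : ι → ℝ} :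
    Memℓp f 2 ↔ Summable fun i => f i ^ 2 := by
  rw [memℓp_gen_iff (by norm_num)]
  simp

theorem lp_two_norm_sq {ι : Type*} (v : lp (fun _ : ι => ℝ) 2) :
    ‖v‖ ^ 2 = ∑' i, v i ^ 2 := by
  have h := lp.norm_rpow_eq_tsum (p := 2) (by norm_num) v
  simpa using h

theorem sq_mul_le_of_abs_le {a C : ℝ} (ha : |a| ≤ C) (x : ℝ) :
    (a * x) ^ 2 ≤ C ^ 2 * x ^ 2 := by
  rw [mul_pow]
  exact mul_le_mul_of_nonneg_right (sq_le_sq' (abs_le.1 ha).1 (abs_le.1 ha).2) (sq_nonneg x)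

theorem summable_sq_weightedComp {ι : Type*} {a : ι → ℝ} {C : ℝ} (ha : ∀ i, |a i| ≤ C)
    (e : ι ≃ ι) (v : lp (fun _ : ι => ℝ) 2) : Summable fun i => (a i * v (e i)) ^ 2 :=
  Summable.of_nonneg_of_le (fun _ => sq_nonneg _) (fun i => sq_mul_le_of_abs_le (ha i) _)
    ((e.summable_iff.2 (memlp_two_iff_summable_sq.1 (lp.memℓp v))).mul_left (C ^ 2))

/-- The weighted composition operator `v ↦ (i ↦ a i * v (e i))` on `ℓ²(ι, ℝ)`, for a weight `a`
bounded by `C` and a permutation `e` of `ι`. -/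
noncomputable def weightedComp {ι : Type*} (a : ι → ℝ) (C : ℝ) (hC : 0 ≤ C)
    (ha : ∀ i, |a i| ≤ C) (e : ι ≃ ι) : lp (fun _ : ι => ℝ) 2 →L[ℝ] lp (fun _ : ι => ℝ) 2 :=
  LinearMap.mkContinuous
    { toFun := fun v => ⟨fun i => a i * v (e i),
        memlp_two_iff_summable_sq.2 (summable_sq_weightedComp ha e v)⟩
      map_add' := fun v w => by
        ext i
        exact mul_add _ _ _
      map_smul' := fun c v => by
        ext i
        exact mul_left_comm _ _ _ } C fun v => by
    refine (sq_le_sq₀ (norm_nonneg _) (mul_nonneg hC (norm_nonneg v))).1 ?_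
    rw [mul_pow, lp_two_norm_sq, lp_two_norm_sq, ← e.tsum_eq fun i => v i ^ 2, ← tsum_mul_left]
    exact (summable_sq_weightedComp ha e v).tsum_le_tsum
      (fun i => sq_mul_le_of_abs_le (ha i) _)
      ((e.summable_iff.2 (memlp_two_iff_summable_sq.1 (lp.memℓp v))).mul_left (C ^ 2))

section weightedComp

variable {ι : Type*} {a b : ι → ℝ} {C : ℝ} (hC : 0 ≤ C) (ha : ∀ i, |a i| ≤ C)
  (hb : ∀ i, |b i| ≤ C)

theorem weightedComp_apply (e : ι ≃ ι) (v : lp (fun _ : ι => ℝ) 2) (i : ι) :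
    weightedComp a C hC ha e v i = a i * v (e i) := rfl

theorem norm_weightedComp_le (e : ι ≃ ι) : ‖weightedComp a C hC ha e‖ ≤ C :=
  LinearMap.mkContinuous_norm_le _ hC _

theorem adjoint_weightedComp (e f : ι ≃ ι) (hf : ∀ i, f (e i) = i) (hab : ∀ i, b (e i) = a i) :
    ContinuousLinearMap.adjoint (weightedComp a C hC ha e) = weightedComp b C hC hb f := by
  symm
  rw [ContinuousLinearMap.eq_adjoint_iff]
  intro v w
  rw [lp.inner_eq_tsum, lp.inner_eq_tsum, ← e.tsum_eq]
  refine tsum_congr fun i => ?_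
  simp only [weightedComp_apply, hf, hab, RCLike.inner_apply, conj_trivial]
  ring

end weightedComp

/-- The symmetric part `S` of the linearization of the KdV difference scheme,
`(S v)_i = -(gτ/(4h))·[(θ_i - θ_{i+1}) v_{i+1} - (θ_i - θ_{i-1}) v_{i-1}
+ 2(θ_{i+1} - θ_{i-1}) v_i]`, is a bounded self-adjoint operator on `ℓ²(ℤ, ℝ)`
with `‖S‖ ≤ (3/2)·|g|·τ·K`, provided the discrete difference quotients of `θ`
are bounded by `K`. -/
theorem stmt_1 (g τ h : ℝ) (hτ : 0 < τ) (hh : 0 < h) (θ : ℤ → ℝ) (K : ℝ) (hK : 0 ≤ K)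
    (hθ1 : ∀ i : ℤ, |θ (i + 1) - θ i| ≤ K * h)
    (hθ2 : ∀ i : ℤ, |θ (i + 1) - θ (i - 1)| ≤ 2 * K * h) :
    ∃ S : lp (fun _ : ℤ => ℝ) 2 →L[ℝ] lp (fun _ : ℤ => ℝ) 2,
      (∀ v : lp (fun _ : ℤ => ℝ) 2, ∀ i : ℤ,
        (S v : ∀ _ : ℤ, ℝ) i =
          -(g * τ / (4 * h)) *
            ((θ i - θ (i + 1)) * (v : ∀ _ : ℤ, ℝ) (i + 1)
              - (θ i - θ (i - 1)) * (v : ∀ _ : ℤ, ℝ) (i - 1)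
              + 2 * (θ (i + 1) - θ (i - 1)) * (v : ∀ _ : ℤ, ℝ) i)) ∧
      ContinuousLinearMap.adjoint S = S ∧
      ‖S‖ ≤ 3 / 2 * |g| * τ * K := by
  have hKh : 0 ≤ K * h := by positivity
  have hKh4 : 0 ≤ 4 * (K * h) := by positivity
  have hr : ∀ i : ℤ, |θ i - θ (i + 1)| ≤ K * h := fun i => by
    rw [abs_sub_comm]
    exact hθ1 i
  have hl : ∀ i : ℤ, |-(θ i - θ (i - 1))| ≤ K * h := fun i => by
    rw [abs_neg]
    simpa using hθ1 (i - 1)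
  have hd : ∀ i : ℤ, |2 * (θ (i + 1) - θ (i - 1))| ≤ 4 * (K * h) := fun i => by
    rw [abs_mul, abs_two]
    linarith [hθ2 i]
  set R := weightedComp _ _ hKh hr (Equiv.addRight (1 : ℤ))
  set L := weightedComp _ _ hKh hl (Equiv.subRight (1 : ℤ))
  set D := weightedComp _ _ hKh4 hd (Equiv.refl ℤ)
  have hR_adj : ContinuousLinearMap.adjoint R = L :=
    adjoint_weightedComp hKh hr hl _ _ (fun i => by simp) fun i => by simp
  have hL_adj : ContinuousLinearMap.adjoint L = R := by
    rw [← hR_adj, ContinuousLinearMap.adjoint_adjoint]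
  have hD_adj : ContinuousLinearMap.adjoint D = D :=
    adjoint_weightedComp hKh4 hd hd _ _ (fun i => rfl) fun i => rfl
  refine ⟨(-(g * τ / (4 * h))) • (R + L + D), fun v i => ?_, ?_, ?_⟩
  · change -(g * τ / (4 * h)) * ((θ i - θ (i + 1)) * v (i + 1) + -(θ i - θ (i - 1)) * v (i - 1)
      + 2 * (θ (i + 1) - θ (i - 1)) * v i) = _
    ring
  · rw [map_smulₛₗ, map_add, map_add, hR_adj, hL_adj, hD_adj, add_comm L R, conj_trivial]
  · have hsum : ‖R + L + D‖ ≤ 6 * (K * h) := by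
      have h₁ := norm_add₃_le (a := R) (b := L) (c := D)
      have h₂ : ‖R‖ ≤ K * h := norm_weightedComp_le hKh hr _
      have h₃ : ‖L‖ ≤ K * h := norm_weightedComp_le hKh hl _
      have h₄ : ‖D‖ ≤ 4 * (K * h) := norm_weightedComp_le hKh4 hd _
      linarith
    calc ‖(-(g * τ / (4 * h))) • (R + L + D)‖
        = |g| * τ / (4 * h) * ‖R + L + D‖ := by
          rw [norm_smul, Real.norm_eq_abs, abs_neg, abs_div, abs_mul, abs_of_pos hτ,
            abs_of_pos (by positivity : 0 < 4 * h)]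
      _ ≤ |g| * τ / (4 * h) * (6 * (K * h)) := by gcongr
      _ = 3 / 2 * |g| * τ * K := by
          field_simp
          ring
end

section
/- Let c, g, e, τ, h be real numbers with τ > 0 and h > 0, let θ : ℤ → ℝ be a sequence, and let M ≥ 0 be such that |θ_i| ≤ M for all i ∈ ℤ. Then the linear operator A on ℓ²(ℤ, ℝ) defined by (A v)_i = −(cτ/(2h))·(v_{i+1} − v_{i−1}) − (gτ/(4h))·[(θ_i + θ_{i+1}) v_{i+1} − (θ_i + θ_{i−1}) v_{i−1}] − (eτ/(2h³))·(v_{i+2} − 2 v_{i+1} + 2 v_{i−1} − v_{i−2}) is a bounded skew-adjoint operator and its operator norm satisfies ‖A‖ ≤ (|g|·τ/h)·M + |c|·τ/h + 3·|e|·τ/h³. -/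
section WeightedShift

variable {α : Type*}

theorem sum_weighted_comp_rpow_le (a : α → ℝ) (σ : Equiv.Perm α) {C : ℝ} (hC : 0 ≤ C)
    (ha : ∀ i, |a i| ≤ C) (v : lp (fun _ : α => ℝ) 2) (s : Finset α) :
    ∑ i ∈ s, ‖a i * v (σ i)‖ ^ (2 : ENNReal).toReal ≤ (C * ‖v‖) ^ (2 : ENNReal).toReal := by
  have h2 : 0 < (2 : ENNReal).toReal := by norm_num
  calc ∑ i ∈ s, ‖a i * v (σ i)‖ ^ (2 : ENNReal).toReal
      ≤ ∑ i ∈ s, C ^ (2 : ENNReal).toReal * ‖v (σ i)‖ ^ (2 : ENNReal).toReal := by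
        gcongr with i
        rw [← Real.mul_rpow hC (norm_nonneg _), norm_mul]
        gcongr
        exact ha i
    _ = C ^ (2 : ENNReal).toReal *
          ∑ j ∈ s.map σ.toEmbedding, ‖v j‖ ^ (2 : ENNReal).toReal := by
        simp [Finset.mul_sum]
    _ ≤ C ^ (2 : ENNReal).toReal * ‖v‖ ^ (2 : ENNReal).toReal := by
        gcongr
        exact lp.sum_rpow_le_norm_rpow h2 v _
    _ = (C * ‖v‖) ^ (2 : ENNReal).toReal := (Real.mul_rpow hC (norm_nonneg _)).symm

theorem exists_weighted_comp (a : α → ℝ) (σ : Equiv.Perm α) {C : ℝ} (hC : 0 ≤ C)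
    (ha : ∀ i, |a i| ≤ C) :
    ∃ W : lp (fun _ : α => ℝ) 2 →L[ℝ] lp (fun _ : α => ℝ) 2,
      (∀ v i, W v i = a i * v (σ i)) ∧ ‖W‖ ≤ C := by
  let W : lp (fun _ : α => ℝ) 2 →ₗ[ℝ] lp (fun _ : α => ℝ) 2 :=
    { toFun := fun v => ⟨fun i => a i * v (σ i),
        memℓp_gen' (sum_weighted_comp_rpow_le a σ hC ha v)⟩
      map_add' := fun u v => by
        ext i
        exact mul_add _ _ _
      map_smul' := fun r v => by
        ext i
        exact mul_left_comm _ _ _ }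
  refine ⟨W.mkContinuous C fun v => ?_, fun v i => rfl, W.mkContinuous_norm_le hC _⟩
  exact lp.norm_le_of_forall_sum_le (by norm_num) (by positivity)
    (sum_weighted_comp_rpow_le a σ hC ha v)

theorem adjoint_weighted_comp_apply {a : α → ℝ} {σ : Equiv.Perm α}
    {W : lp (fun _ : α => ℝ) 2 →L[ℝ] lp (fun _ : α => ℝ) 2}
    (hW : ∀ v i, W v i = a i * v (σ i)) (v : lp (fun _ : α => ℝ) 2) (i : α) :
    ContinuousLinearMap.adjoint W v i = a (σ.symm i) * v (σ.symm i) := by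
  classical
  have hsingle : W (lp.single 2 i 1) = lp.single 2 (σ.symm i) (a (σ.symm i)) := by
    ext j
    rw [hW]
    by_cases hj : j = σ.symm i
    · subst hj
      simp
    · have hj' : σ j ≠ i := fun h => hj (by simp [← h])
      simp [lp.single_apply, hj, hj']
  have h := ContinuousLinearMap.adjoint_inner_right W (lp.single 2 i 1) v
  rw [hsingle, lp.inner_single_left, lp.inner_single_left] at h
  simpa [mul_comm] using h

end WeightedShift


/-- The antisymmetric part `A` of the linearization of the KdV difference scheme,
`(A v)_i = -(cτ/(2h))·(v_{i+1} - v_{i-1})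
- (gτ/(4h))·[(θ_i + θ_{i+1}) v_{i+1} - (θ_i + θ_{i-1}) v_{i-1}]
- (eτ/(2h³))·(v_{i+2} - 2 v_{i+1} + 2 v_{i-1} - v_{i-2})`, is a bounded
skew-adjoint operator on `ℓ²(ℤ, ℝ)` with
`‖A‖ ≤ (|g|τ/h)·M + |c|τ/h + 3|e|τ/h³`, provided `|θ_i| ≤ M` for all `i`. -/
theorem stmt_2 (c g e τ h : ℝ) (hτ : 0 < τ) (hh : 0 < h) (θ : ℤ → ℝ) (M : ℝ) (hM : 0 ≤ M)
    (hθ : ∀ i : ℤ, |θ i| ≤ M) :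
    ∃ A : lp (fun _ : ℤ => ℝ) 2 →L[ℝ] lp (fun _ : ℤ => ℝ) 2,
      (∀ v : lp (fun _ : ℤ => ℝ) 2, ∀ i : ℤ,
        (A v : ∀ _ : ℤ, ℝ) i =
          -(c * τ / (2 * h)) * ((v : ∀ _ : ℤ, ℝ) (i + 1) - (v : ∀ _ : ℤ, ℝ) (i - 1))
            - g * τ / (4 * h) *
              ((θ i + θ (i + 1)) * (v : ∀ _ : ℤ, ℝ) (i + 1)
                - (θ i + θ (i - 1)) * (v : ∀ _ : ℤ, ℝ) (i - 1))
            - e * τ / (2 * h ^ 3) *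
              ((v : ∀ _ : ℤ, ℝ) (i + 2) - 2 * (v : ∀ _ : ℤ, ℝ) (i + 1)
                + 2 * (v : ∀ _ : ℤ, ℝ) (i - 1) - (v : ∀ _ : ℤ, ℝ) (i - 2))) ∧
      ContinuousLinearMap.adjoint A = -A ∧
      ‖A‖ ≤ |g| * τ / h * M + |c| * τ / h + 3 * |e| * τ / h ^ 3 := by
  have hweight : ∀ i, |-(c * τ / (2 * h)) - g * τ / (4 * h) * (θ i + θ (i + 1))
      + e * τ / h ^ 3| ≤ |c| * τ / (2 * h) + |g| * τ / (4 * h) * (2 * M) + |e| * τ / h ^ 3 := by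
    intro i
    have hc : |c * τ / (2 * h)| = |c| * τ / (2 * h) := by
      rw [abs_div, abs_mul, abs_of_pos hτ, abs_of_pos (by positivity : 0 < 2 * h)]
    have hg : |g * τ / (4 * h)| = |g| * τ / (4 * h) := by
      rw [abs_div, abs_mul, abs_of_pos hτ, abs_of_pos (by positivity : 0 < 4 * h)]
    have he : |e * τ / h ^ 3| = |e| * τ / h ^ 3 := by
      rw [abs_div, abs_mul, abs_of_pos hτ, abs_of_pos (by positivity : 0 < h ^ 3)]
    have hsum : |θ i + θ (i + 1)| ≤ 2 * M := by
      linarith [abs_add_le (θ i) (θ (i + 1)), hθ i, hθ (i + 1)]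
    refine (abs_add_le _ _).trans (add_le_add ((abs_sub _ _).trans (add_le_add ?_ ?_)) he.le)
    · rw [abs_neg, hc]
    · rw [abs_mul, hg]
      gcongr
  have hweight₂ : ∀ _ : ℤ, |-(e * τ / (2 * h ^ 3))| ≤ |e| * τ / (2 * h ^ 3) := fun _ => by
    rw [abs_neg, abs_div, abs_mul, abs_of_pos hτ, abs_of_pos (by positivity : 0 < 2 * h ^ 3)]
  obtain ⟨U, hU, hUnorm⟩ :=
    exists_weighted_comp _ (Equiv.addRight (1 : ℤ)) (by positivity) hweight
  obtain ⟨V, hV, hVnorm⟩ :=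
    exists_weighted_comp _ (Equiv.addRight (2 : ℤ)) (by positivity) hweight₂
  refine ⟨(U + V) - ContinuousLinearMap.adjoint (U + V), fun v i => ?_, ?_, ?_⟩
  · have hcoord : ((U + V) - ContinuousLinearMap.adjoint (U + V)) v i =
        U v i + V v i -
          (ContinuousLinearMap.adjoint U v i + ContinuousLinearMap.adjoint V v i) := by
      rw [map_add]
      rfl
    rw [hcoord, adjoint_weighted_comp_apply hU, adjoint_weighted_comp_apply hV, hU, hV]
    simp only [Equiv.coe_addRight, Equiv.addRight_symm, ← sub_eq_add_neg, sub_add_cancel]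
    field_simp
    ring
  · rw [map_sub, ContinuousLinearMap.adjoint_adjoint, neg_sub]
  · calc ‖(U + V) - ContinuousLinearMap.adjoint (U + V)‖
        ≤ ‖U + V‖ + ‖ContinuousLinearMap.adjoint (U + V)‖ := norm_sub_le _ _
      _ = 2 * ‖U + V‖ := by rw [LinearIsometryEquiv.norm_map]; ring
      _ ≤ 2 * ((|c| * τ / (2 * h) + |g| * τ / (4 * h) * (2 * M) + |e| * τ / h ^ 3) +
            |e| * τ / (2 * h ^ 3)) := by
          gcongr
          exact (norm_add_le _ _).trans (add_le_add hUnorm hVnorm)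
      _ = |g| * τ / h * M + |c| * τ / h + 3 * |e| * τ / h ^ 3 := by
          field_simp
          ring
end

section
/- Let c, g, e, τ, h be real numbers with τ > 0 and h > 0, let θ : ℤ → ℝ be a sequence, and let K, M ≥ 0 be such that |θ_{i+1} − θ_i| ≤ K·h, |θ_{i+1} − θ_{i−1}| ≤ 2K·h, and |θ_i| ≤ M for all i ∈ ℤ. Then the linearization T of the scheme, i.e. the operator on ℓ²(ℤ, ℝ) defined by (T v)_i = v_i − (cτ/(2h))(v_{i+1} − v_{i−1}) − (gτ/(2h))·[θ_i (v_{i+1} − v_{i−1}) + v_i (θ_{i+1} − θ_{i−1})] − (eτ/(2h³))·(v_{i+2} − 2 v_{i+1} + 2 v_{i−1} − v_{i−2}), is bounded and satisfies ‖T‖² ≤ e^{aτ} with a = 3|g|K + τ·(3|g|K + (|g|/h)M + |c|/h + 3|e|/h³)². -/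
open scoped InnerProductSpace

/-- If `v` is square-summable and `a` is bounded by `C`, then `i ↦ a i * v (i + k)` has summable
squares, with sum at most `C ^ 2 * ‖v‖ ^ 2`. -/
lemma summable_sq_weighted_shift {a : ℤ → ℝ} {C : ℝ} (ha : ∀ i, |a i| ≤ C) (k : ℤ)
    (v : lp (fun _ : ℤ => ℝ) 2) :
    Summable (fun i => (a i * v (i + k)) ^ 2) ∧
      ∑' i, (a i * v (i + k)) ^ 2 ≤ C ^ 2 * ‖v‖ ^ 2 := by
  have hv : HasSum (fun i => v i ^ 2) (‖v‖ ^ 2) := by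
    simpa [← sq] using lp.hasSum_inner (𝕜 := ℝ) v v
  have hs : HasSum (fun i => C ^ 2 * v (i + k) ^ 2) (C ^ 2 * ‖v‖ ^ 2) :=
    ((Equiv.addRight k).hasSum_iff.mpr hv).mul_left _
  have hle : ∀ i, (a i * v (i + k)) ^ 2 ≤ C ^ 2 * v (i + k) ^ 2 := fun i => by
    rw [mul_pow]
    exact mul_le_mul_of_nonneg_right (sq_le_sq' (abs_le.mp (ha i)).1 (abs_le.mp (ha i)).2)
      (sq_nonneg _)
  have hsum := Summable.of_nonneg_of_le (fun i => sq_nonneg _) hle hs.summable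
  exact ⟨hsum, hs.tsum_eq ▸ hsum.tsum_le_tsum hle hs.summable⟩

/-- The bounded operator `v ↦ (a i * v (i + k))_i` on `ℓ²(ℤ, ℝ)`, for a bounded weight `a`. -/
noncomputable def weightedShift (a : ℤ → ℝ) (C : ℝ) (ha : ∀ i, |a i| ≤ C) (k : ℤ) :
    lp (fun _ : ℤ => ℝ) 2 →L[ℝ] lp (fun _ : ℤ => ℝ) 2 :=
  LinearMap.mkContinuous
    { toFun := fun v => ⟨fun i => a i * v (i + k), memℓp_gen (by
        simpa [mul_pow] using (summable_sq_weighted_shift ha k v).1)⟩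
      map_add' := fun v w => by
        ext i
        exact mul_add _ _ _
      map_smul' := fun r v => by
        ext i
        exact mul_left_comm _ _ _ }
    C (fun v => by
      refine abs_le_of_sq_le_sq' ?_ (mul_nonneg ((abs_nonneg _).trans (ha 0)) (norm_nonneg _)) |>.2
      rw [← real_inner_self_eq_norm_sq, lp.inner_eq_tsum, mul_pow]
      simpa [← sq, mul_pow] using (summable_sq_weighted_shift ha k v).2)

section weightedShift

variable {a : ℤ → ℝ} {C : ℝ} (ha : ∀ i, |a i| ≤ C) (k : ℤ)

@[simp]
lemma weightedShift_apply (v : lp (fun _ : ℤ => ℝ) 2) (i : ℤ) :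
    weightedShift a C ha k v i = a i * v (i + k) := rfl

lemma norm_weightedShift_apply_le (v : lp (fun _ : ℤ => ℝ) 2) :
    ‖weightedShift a C ha k v‖ ≤ C * ‖v‖ :=
  (weightedShift a C ha k).le_of_opNorm_le
    (LinearMap.mkContinuous_norm_le _ ((abs_nonneg _).trans (ha 0)) _) v

lemma abs_inner_weightedShift_le (v : lp (fun _ : ℤ => ℝ) 2) :
    |⟪v, weightedShift a C ha k v⟫_ℝ| ≤ C * ‖v‖ ^ 2 := by
  nlinarith [abs_real_inner_le_norm v (weightedShift a C ha k v),
    norm_weightedShift_apply_le ha k v, norm_nonneg v]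

/-- Summation by parts: the quadratic form of the shift by `-k` with weight `a` is that of the
shift by `k` with the translated weight. -/
lemma inner_weightedShift_neg (v : lp (fun _ : ℤ => ℝ) 2) :
    ⟪v, weightedShift a C ha (-k) v⟫_ℝ =
      ⟪v, weightedShift (fun i => a (i + k)) C (fun i => ha (i + k)) k v⟫_ℝ := by
  rw [lp.inner_eq_tsum, lp.inner_eq_tsum, ← (Equiv.addRight k).tsum_eq]
  refine tsum_congr fun i => ?_
  simp
  ring

end weightedShift

/-- A forward Euler step `1 - τ A` satisfies `‖1 - τ A‖ ^ 2 ≤ exp ((b + τ B ^ 2) τ)` as soon as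
`-2 ⟪v, A v⟫ ≤ b ‖v‖ ^ 2` and `‖A v‖ ≤ B ‖v‖` for all `v`. -/
lemma sq_norm_one_sub_smul_le_exp {E : Type*} [NormedAddCommGroup E] [InnerProductSpace ℝ E]
    (A : E →L[ℝ] E) {b B τ : ℝ} (hτ : 0 ≤ τ) (hb : 0 ≤ b)
    (hinner : ∀ v, -(2 * ⟪v, A v⟫_ℝ) ≤ b * ‖v‖ ^ 2) (hnorm : ∀ v, ‖A v‖ ≤ B * ‖v‖) :
    ‖1 - τ • A‖ ^ 2 ≤ Real.exp ((b + τ * B ^ 2) * τ) := by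
  have h0 : 0 ≤ 1 + (b + τ * B ^ 2) * τ := by positivity
  have hle : ‖1 - τ • A‖ ≤ √(1 + (b + τ * B ^ 2) * τ) := by
    refine ContinuousLinearMap.opNorm_le_bound _ (Real.sqrt_nonneg _) fun v => ?_
    refine le_of_sq_le_sq ?_ (by positivity)
    rw [mul_pow, Real.sq_sqrt h0]
    have h1 : ‖(1 - τ • A) v‖ ^ 2 = ‖v‖ ^ 2 - 2 * (τ * ⟪v, A v⟫_ℝ) + τ ^ 2 * ‖A v‖ ^ 2 := by
      simp [norm_sub_sq_real, inner_smul_right, norm_smul, mul_pow]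
    have h2 := mul_le_mul_of_nonneg_left (hinner v) hτ
    have h3 := mul_le_mul_of_nonneg_left
      (pow_le_pow_left₀ (norm_nonneg _) (hnorm v) 2) (sq_nonneg τ)
    rw [h1]
    linarith
  calc ‖1 - τ • A‖ ^ 2 ≤ √(1 + (b + τ * B ^ 2) * τ) ^ 2 :=
        pow_le_pow_left₀ (norm_nonneg _) hle 2
    _ = (b + τ * B ^ 2) * τ + 1 := by rw [Real.sq_sqrt h0, add_comm]
    _ ≤ _ := Real.add_one_le_exp _


/-- The linearization `T` of one step of the Lax–Wendroff-type scheme for the KdV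
equation is a bounded operator on `ℓ²(ℤ, ℝ)` satisfying the conditional-stability
estimate `‖T‖² ≤ exp(aτ)` with
`a = 3|g|K + τ·(3|g|K + (|g|/h)M + |c|/h + 3|e|/h³)²`. -/
theorem stmt_3 (c g e τ h : ℝ) (hτ : 0 < τ) (hh : 0 < h) (θ : ℤ → ℝ) (K M : ℝ)
    (hK : 0 ≤ K) (hM : 0 ≤ M)
    (hθ1 : ∀ i : ℤ, |θ (i + 1) - θ i| ≤ K * h)
    (hθ2 : ∀ i : ℤ, |θ (i + 1) - θ (i - 1)| ≤ 2 * K * h)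
    (hθ3 : ∀ i : ℤ, |θ i| ≤ M) :
    ∃ T : lp (fun _ : ℤ => ℝ) 2 →L[ℝ] lp (fun _ : ℤ => ℝ) 2,
      (∀ v : lp (fun _ : ℤ => ℝ) 2, ∀ i : ℤ,
        (T v : ∀ _ : ℤ, ℝ) i =
          (v : ∀ _ : ℤ, ℝ) i
            - c * τ / (2 * h) * ((v : ∀ _ : ℤ, ℝ) (i + 1) - (v : ∀ _ : ℤ, ℝ) (i - 1))
            - g * τ / (2 * h) *
              (θ i * ((v : ∀ _ : ℤ, ℝ) (i + 1) - (v : ∀ _ : ℤ, ℝ) (i - 1))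
                + (v : ∀ _ : ℤ, ℝ) i * (θ (i + 1) - θ (i - 1)))
            - e * τ / (2 * h ^ 3) *
              ((v : ∀ _ : ℤ, ℝ) (i + 2) - 2 * (v : ∀ _ : ℤ, ℝ) (i + 1)
                + 2 * (v : ∀ _ : ℤ, ℝ) (i - 1) - (v : ∀ _ : ℤ, ℝ) (i - 2))) ∧
      ‖T‖ ^ 2 ≤
        Real.exp ((3 * |g| * K +
          τ * (3 * |g| * K + |g| / h * M + |c| / h + 3 * |e| / h ^ 3) ^ 2) * τ) := by
  have h_one : ∀ i : ℤ, |(fun _ : ℤ => (1 : ℝ)) i| ≤ 1 := by simp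
  let S := weightedShift (fun _ => 1) 1 h_one
  let W := weightedShift θ M hθ3
  let D := weightedShift (fun i => θ (i + 1) - θ (i - 1)) (2 * K * h) hθ2 0
  let A := (c / (2 * h)) • (S 1 - S (-1)) + (g / (2 * h)) • (W 1 - W (-1) + D)
    + (e / (2 * h ^ 3)) • (S 2 - (2 : ℝ) • S 1 + (2 : ℝ) • S (-1) - S (-2))
  refine ⟨1 - τ • A, fun v i => ?_, sq_norm_one_sub_smul_le_exp A hτ.le (by positivity)
    (fun v => ?_) (fun v => ?_)⟩
  · change v i - τ * (c / (2 * h) * (1 * v (i + 1) - 1 * v (i - 1))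
        + g / (2 * h) * (θ i * v (i + 1) - θ i * v (i - 1)
          + (θ (i + 1) - θ (i - 1)) * v (i + 0))
        + e / (2 * h ^ 3) * (1 * v (i + 2) - 2 * (1 * v (i + 1)) + 2 * (1 * v (i - 1))
          - 1 * v (i - 2))) = _
    rw [add_zero]
    ring
  · have hS : ∀ k, ⟪v, S (-k) v⟫_ℝ = ⟪v, S k v⟫_ℝ := fun k => inner_weightedShift_neg h_one k v
    let F := weightedShift (fun i => θ (i + 1) - θ i) (K * h) hθ1 1
    have hW : ⟪v, W (-1) v⟫_ℝ = ⟪v, W 1 v⟫_ℝ + ⟪v, F v⟫_ℝ := by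
      rw [inner_weightedShift_neg hθ3 1 v, ← inner_add_right]
      congr 1
      ext i
      simp [W, F]
      ring
    have hA : -(2 * ⟪v, A v⟫_ℝ) = g / h * (⟪v, F v⟫_ℝ - ⟪v, D v⟫_ℝ) := by
      simp [A, inner_add_right, inner_sub_right, inner_smul_right, hS, hW]
      field_simp
      ring
    have hF : |⟪v, F v⟫_ℝ| ≤ K * h * ‖v‖ ^ 2 := abs_inner_weightedShift_le hθ1 1 v
    have hD : |⟪v, D v⟫_ℝ| ≤ 2 * K * h * ‖v‖ ^ 2 := abs_inner_weightedShift_le hθ2 0 v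
    calc -(2 * ⟪v, A v⟫_ℝ) ≤ |g / h| * |⟪v, F v⟫_ℝ - ⟪v, D v⟫_ℝ| := by
          rw [hA, ← abs_mul]
          exact le_abs_self _
      _ ≤ |g| / h * (K * h * ‖v‖ ^ 2 + 2 * K * h * ‖v‖ ^ 2) := by
          rw [abs_div, abs_of_pos hh]
          gcongr
          exact (abs_sub _ _).trans (add_le_add hF hD)
      _ = 3 * |g| * K * ‖v‖ ^ 2 := by
          field_simp
          ring
  · have hS : ∀ k, ‖S k v‖ ≤ ‖v‖ := fun k => by
      simpa using norm_weightedShift_apply_le h_one k v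
    have hW : ∀ k, ‖W k v‖ ≤ M * ‖v‖ := fun k => norm_weightedShift_apply_le hθ3 k v
    have hD : ‖D v‖ ≤ 2 * K * h * ‖v‖ := norm_weightedShift_apply_le hθ2 0 v
    have hc : ‖S 1 v - S (-1) v‖ ≤ 2 * ‖v‖ := by
      linarith [norm_sub_le (S 1 v) (S (-1) v), hS 1, hS (-1)]
    have hg : ‖W 1 v - W (-1) v + D v‖ ≤ 2 * (M + K * h) * ‖v‖ := by
      linarith [norm_add_le (W 1 v - W (-1) v) (D v), norm_sub_le (W 1 v) (W (-1) v),
        hW 1, hW (-1)]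
    have he : ‖S 2 v - (2 : ℝ) • S 1 v + (2 : ℝ) • S (-1) v - S (-2) v‖ ≤ 6 * ‖v‖ := by
      have h_two : ∀ w : lp (fun _ : ℤ => ℝ) 2, ‖(2 : ℝ) • w‖ = 2 * ‖w‖ := by simp [norm_smul]
      linarith [norm_sub_le (S 2 v - (2 : ℝ) • S 1 v + (2 : ℝ) • S (-1) v) (S (-2) v),
        norm_add_le (S 2 v - (2 : ℝ) • S 1 v) ((2 : ℝ) • S (-1) v),
        norm_sub_le (S 2 v) ((2 : ℝ) • S 1 v), h_two (S 1 v), h_two (S (-1) v),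
        hS 1, hS 2, hS (-1), hS (-2)]
    calc ‖A v‖ ≤ |c / (2 * h)| * ‖S 1 v - S (-1) v‖ + |g / (2 * h)| * ‖W 1 v - W (-1) v + D v‖
          + |e / (2 * h ^ 3)| * ‖S 2 v - (2 : ℝ) • S 1 v + (2 : ℝ) • S (-1) v - S (-2) v‖ := by
          simp only [← Real.norm_eq_abs, ← norm_smul]
          exact norm_add₃_le
      _ ≤ |c| / (2 * h) * (2 * ‖v‖) + |g| / (2 * h) * (2 * (M + K * h) * ‖v‖)
          + |e| / (2 * h ^ 3) * (6 * ‖v‖) := by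
          rw [abs_div, abs_div, abs_div, abs_of_pos (show 0 < 2 * h by positivity),
            abs_of_pos (show 0 < 2 * h ^ 3 by positivity)]
          gcongr
      _ = (|g| * K + |g| / h * M + |c| / h + 3 * |e| / h ^ 3) * ‖v‖ := by
          field_simp
          ring
      _ ≤ (3 * |g| * K + |g| / h * M + |c| / h + 3 * |e| / h ^ 3) * ‖v‖ := by
          gcongr
          linarith [abs_nonneg g]
end

section
/- Let θ₁, θ₂ : ℝ × ℝ → ℝ be smooth functions of (x,t) satisfying the Hirota–Satsuma system ∂ₜθ₁ − 0.25·∂ₓ³θ₁ − 1.5·θ₁·∂ₓθ₁ + 3·θ₂·∂ₓθ₂ = 0 and ∂ₜθ₂ + 0.5·∂ₓ³θ₂ + 1.5·θ₁·∂ₓθ₂ = 0 at every point, and suppose there is a compact set K ⊆ ℝ such that for all t in a closed interval [t₀, t₁], θ₁(x,t) = 0 and θ₂(x,t) = 0 whenever x ∉ K. Then the quantity I(t) = ∫_ℝ (0.5·θ₁(x,t)² − θ₂(x,t)²) dx is constant on [t₀, t₁], i.e. I(t) = I(t₀) for all t ∈ [t₀, t₁]. -/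
open MeasureTheory Set Filter Topology

/-- The partial derivative of a `C¹` function of two real variables in the second variable is
jointly continuous. -/
theorem ContDiff.continuous_deriv_snd {f : ℝ → ℝ → ℝ}
    (hf : ContDiff ℝ 1 fun p : ℝ × ℝ => f p.1 p.2) :
    Continuous fun p : ℝ × ℝ => deriv (f p.1) p.2 := by
  have h : (fun p : ℝ × ℝ => deriv (f p.1) p.2) =
      fun p => fderiv ℝ (fun p : ℝ × ℝ => f p.1 p.2) p (0, 1) := by
    funext p
    exact ((hf.differentiable one_ne_zero p).hasFDerivAt.comp_hasDerivAt p.2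
      ((hasDerivAt_const p.2 p.1).prodMk (hasDerivAt_id p.2))).deriv
  rw [h]
  exact (hf.continuous_fderiv one_ne_zero).clm_apply continuous_const

/-- Integrated form of differentiation under the integral sign. -/
theorem intervalIntegral_sub_eq_intervalIntegral_deriv {f : ℝ → ℝ → ℝ}
    (hf : ContDiff ℝ 1 fun p : ℝ × ℝ => f p.1 p.2) (a b c d : ℝ) :
    (∫ x in a..b, f x d) - ∫ x in a..b, f x c = ∫ s in c..d, ∫ x in a..b, deriv (f x) s := by
  have hc := hf.continuous_deriv_snd
  have hf' : ∀ s, Continuous fun x => f x s := fun s =>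
    hf.continuous.comp (by fun_prop : Continuous fun x : ℝ => (x, s))
  have hint : IntegrableOn (Function.uncurry fun x s => deriv (f x) s)
      (uIoc a b ×ˢ uIoc c d) :=
    (hc.continuousOn.integrableOn_compact (isCompact_uIcc.prod isCompact_uIcc)).mono_set
      (prod_mono uIoc_subset_uIcc uIoc_subset_uIcc)
  rw [← intervalIntegral_intervalIntegral_swap hint,
    ← intervalIntegral.integral_sub ((hf' d).intervalIntegrable a b)
      ((hf' c).intervalIntegrable a b)]
  refine intervalIntegral.integral_congr fun x _ => ?_
  have hx : ContDiff ℝ 1 (f x) := hf.comp (contDiff_const.prodMk contDiff_id)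
  exact (intervalIntegral.integral_deriv_eq_sub
    (fun s _ => hx.differentiable one_ne_zero s)
    ((hx.continuous_deriv le_rfl).intervalIntegrable c d)).symm

/-- The flux of the conserved density `0.5 u² - v²` of the Hirota–Satsuma system, with the opposite
sign. -/
noncomputable def hirotaSatsumaFlux (u v : ℝ → ℝ) (x : ℝ) : ℝ :=
  0.5 * u x ^ 3 + 0.25 * u x * iteratedDeriv 2 u x - 0.125 * deriv u x ^ 2
    + v x * iteratedDeriv 2 v x - 0.5 * deriv v x ^ 2

theorem hasDerivAt_hirotaSatsumaFlux {u v : ℝ → ℝ} (hu : ContDiff ℝ 3 u) (hv : ContDiff ℝ 3 v)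
    (x : ℝ) :
    HasDerivAt (hirotaSatsumaFlux u v)
      (1.5 * u x ^ 2 * deriv u x + 0.25 * u x * iteratedDeriv 3 u x
        + v x * iteratedDeriv 3 v x) x := by
  have key : ∀ {w : ℝ → ℝ}, ContDiff ℝ 3 w → HasDerivAt w (deriv w x) x ∧
      HasDerivAt (deriv w) (iteratedDeriv 2 w x) x ∧
      HasDerivAt (iteratedDeriv 2 w) (iteratedDeriv 3 w x) x := by
    intro w hw
    refine ⟨(hw.differentiable (by norm_num) x).hasDerivAt, ?_, ?_⟩
    · have := (hw.differentiable_iteratedDeriv 1 (by norm_num) x).hasDerivAt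
      rwa [← iteratedDeriv_succ, iteratedDeriv_one] at this
    · have := (hw.differentiable_iteratedDeriv 2 (by norm_num) x).hasDerivAt
      rwa [← iteratedDeriv_succ] at this
  obtain ⟨u₀, u₁, u₂⟩ := key hu
  obtain ⟨v₀, v₁, v₂⟩ := key hv
  refine ((((((u₀.pow 3).const_mul 0.5).add ((u₀.const_mul 0.25).mul u₂)).sub
    ((u₁.pow 2).const_mul 0.125)).add (v₀.mul v₂)).sub ((v₁.pow 2).const_mul 0.5)).congr_deriv ?_
  norm_num
  ring

theorem hirotaSatsumaFlux_eq_zero {u v : ℝ → ℝ} {x : ℝ} (hu : u =ᶠ[𝓝 x] 0) (hv : v =ᶠ[𝓝 x] 0) :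
    hirotaSatsumaFlux u v x = 0 := by
  have hu' : deriv u x = 0 := by simpa using hu.deriv_eq
  have hv' : deriv v x = 0 := by simpa using hv.deriv_eq
  simp [hirotaSatsumaFlux, hu.eq_of_nhds, hv.eq_of_nhds, hu', hv']

/-- Conservation of `∫ (0.5θ₁² - θ₂²) dx` for smooth solutions of the
Hirota–Satsuma system that are compactly supported in `x` uniformly on the time
interval `[t₀, t₁]`. -/
theorem stmt_11 (θ₁ θ₂ : ℝ → ℝ → ℝ)
    (h₁ : ContDiff ℝ (⊤ : ℕ∞) fun p : ℝ × ℝ => θ₁ p.1 p.2)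
    (h₂ : ContDiff ℝ (⊤ : ℕ∞) fun p : ℝ × ℝ => θ₂ p.1 p.2)
    (hs₁ : ∀ x t : ℝ,
      deriv (fun s => θ₁ x s) t - 0.25 * iteratedDeriv 3 (fun y => θ₁ y t) x
        - 1.5 * θ₁ x t * deriv (fun y => θ₁ y t) x
        + 3 * θ₂ x t * deriv (fun y => θ₂ y t) x = 0)
    (hs₂ : ∀ x t : ℝ,
      deriv (fun s => θ₂ x s) t + 0.5 * iteratedDeriv 3 (fun y => θ₂ y t) x
        + 1.5 * θ₁ x t * deriv (fun y => θ₂ y t) x = 0)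
    (t₀ t₁ : ℝ) (ht : t₀ ≤ t₁)
    (K : Set ℝ) (hK : IsCompact K)
    (hsupp : ∀ t ∈ Set.Icc t₀ t₁, ∀ x : ℝ, x ∉ K → θ₁ x t = 0 ∧ θ₂ x t = 0) :
    ∀ t ∈ Set.Icc t₀ t₁,
      ∫ x : ℝ, (0.5 * (θ₁ x t) ^ 2 - (θ₂ x t) ^ 2) =
        ∫ x : ℝ, (0.5 * (θ₁ x t₀) ^ 2 - (θ₂ x t₀) ^ 2) := by
  intro t htI
  have sliceX : ∀ {θ : ℝ → ℝ → ℝ}, ContDiff ℝ (⊤ : ℕ∞) (fun p : ℝ × ℝ => θ p.1 p.2) →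
      ∀ s, ContDiff ℝ (⊤ : ℕ∞) fun y => θ y s := fun h s =>
    h.comp (contDiff_id.prodMk contDiff_const)
  have sliceT : ∀ {θ : ℝ → ℝ → ℝ}, ContDiff ℝ (⊤ : ℕ∞) (fun p : ℝ × ℝ => θ p.1 p.2) →
      ∀ x s, HasDerivAt (fun r => θ x r) (deriv (fun r => θ x r) s) s := fun h x s =>
    ((h.comp (contDiff_const.prodMk contDiff_id)).differentiable (by simp) s).hasDerivAt
  let ρ : ℝ → ℝ → ℝ := fun x s => 0.5 * (θ₁ x s) ^ 2 - (θ₂ x s) ^ 2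
  have hρ : ContDiff ℝ 1 fun p : ℝ × ℝ => ρ p.1 p.2 :=
    ((contDiff_const.mul (h₁.pow 2)).sub (h₂.pow 2)).of_le (by exact_mod_cast le_top)
  obtain ⟨R, hR⟩ := hK.isBounded.subset_ball 0
  rw [Real.ball_eq_Ioo, zero_sub, zero_add] at hR
  have eq_interval : ∀ s ∈ Icc t₀ t₁, ∫ x, ρ x s = ∫ x in (-R)..R, ρ x s := by
    intro s hs
    refine (intervalIntegral.integral_eq_integral_of_support_subset fun x hx => ?_).symm
    by_contra hxR
    obtain ⟨e₁, e₂⟩ := hsupp s hs x fun hxK => hxR (Ioo_subset_Ioc_self (hR hxK))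
    exact hx (by simp [ρ, e₁, e₂])
  have flux_zero : ∀ s ∈ Icc t₀ t₁, ∀ x ∉ K,
      hirotaSatsumaFlux (fun y => θ₁ y s) (fun y => θ₂ y s) x = 0 := fun s hs x hx =>
    hirotaSatsumaFlux_eq_zero
      (eventually_of_mem (hK.isClosed.isOpen_compl.mem_nhds hx) fun y hy => (hsupp s hs y hy).1)
      (eventually_of_mem (hK.isClosed.isOpen_compl.mem_nhds hx) fun y hy => (hsupp s hs y hy).2)
  have conservation : ∀ x s, HasDerivAt
      (hirotaSatsumaFlux (fun y => θ₁ y s) (fun y => θ₂ y s)) (deriv (ρ x) s) x := by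
    intro x s
    have hd : HasDerivAt (ρ x) _ s :=
      (((sliceT h₁ x s).pow 2).const_mul 0.5).sub ((sliceT h₂ x s).pow 2)
    refine (hasDerivAt_hirotaSatsumaFlux (contDiff_infty.1 (sliceX h₁ s) 3)
      (contDiff_infty.1 (sliceX h₂ s) 3) x).congr_deriv ?_
    rw [hd.deriv]
    norm_num
    linear_combination (-θ₁ x s) * hs₁ x s + 2 * θ₂ x s * hs₂ x s
  have inner_zero : ∀ s ∈ Icc t₀ t₁, ∫ x in (-R)..R, deriv (ρ x) s = 0 := by
    intro s hs
    have hc : Continuous fun x => deriv (ρ x) s :=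
      hρ.continuous_deriv_snd.comp (by fun_prop : Continuous fun x : ℝ => (x, s))
    rw [intervalIntegral.integral_eq_sub_of_hasDerivAt (fun x _ => conservation x s)
      (hc.intervalIntegrable _ _), flux_zero s hs R fun h => (hR h).2.ne rfl,
      flux_zero s hs (-R) fun h => (hR h).1.ne rfl, sub_zero]
  change ∫ x, ρ x t = ∫ x, ρ x t₀
  rw [eq_interval t htI, eq_interval t₀ (left_mem_Icc.2 ht), ← sub_eq_zero,
    intervalIntegral_sub_eq_intervalIntegral_deriv hρ]
  rw [intervalIntegral.integral_congr (g := fun _ => 0), intervalIntegral.integral_zero]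
  intro s hs
  rw [uIcc_of_le htI.1] at hs
  exact inner_zero s ⟨hs.1, hs.2.trans htI.2⟩
end

section
/- Let f : ℝ → ℝ be five-times continuously differentiable with |f⁽⁵⁾(y)| ≤ K for all y ∈ ℝ, where K ≥ 0. Then for every x ∈ ℝ and every h > 0, |(f(x+h) − f(x−h))/(2h) − (h²/6)·(f(x+2h) − 2f(x+h) + 2f(x−h) − f(x−2h))/(2h³) − f'(x)| ≤ K·h⁴. -/
open Set in
/-- Taylor's theorem on the line with a uniform bound on the remainder. -/
theorem abs_sub_sum_iteratedDeriv_le {f : ℝ → ℝ} {K : ℝ} {n : ℕ}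
    (hf : ContDiff ℝ (n + 1) f) (hb : ∀ y : ℝ, |iteratedDeriv (n + 1) f y| ≤ K) (x : ℝ)
    {t : ℝ} (ht : t ≠ 0) :
    |f (x + t) - ∑ k ∈ Finset.range (n + 1), iteratedDeriv k f x * t ^ k / k.factorial|
      ≤ K * |t| ^ (n + 1) / (n + 1).factorial := by
  have hx : x ≠ x + t := by simpa using ht
  obtain ⟨y, -, hy⟩ := taylor_mean_remainder_lagrange_iteratedDeriv hx
    (hf.contDiffOn (s := uIcc x (x + t)))
  have hT : taylorWithinEval f n (uIcc x (x + t)) x (x + t) =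
      ∑ k ∈ Finset.range (n + 1), iteratedDeriv k f x * t ^ k / k.factorial := by
    rw [taylor_within_apply]
    refine Finset.sum_congr rfl fun k hk => ?_
    have hk' : (k : WithTop ℕ∞) ≤ n + 1 := by
      exact_mod_cast (Finset.mem_range.mp hk).le
    rw [iteratedDerivWithin_eq_iteratedDeriv (uniqueDiffOn_uIcc hx)
      (hf.of_le hk').contDiffAt left_mem_uIcc, smul_eq_mul, add_sub_cancel_left]
    ring
  rw [← hT, hy, add_sub_cancel_left, abs_div, abs_mul, abs_pow, Nat.abs_cast]
  gcongr
  exact hb y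

/-- Fourth-order consistency of the corrected central difference for the first
derivative: for `f` five-times continuously differentiable with
`|f⁽⁵⁾| ≤ K`, the combination
`(f(x+h) - f(x-h))/(2h) - (h²/6)(f(x+2h) - 2f(x+h) + 2f(x-h) - f(x-2h))/(2h³)`
approximates `f'(x)` with error at most `K h⁴`. -/
theorem stmt_14 (f : ℝ → ℝ) (K : ℝ) (hK : 0 ≤ K)
    (hf : ContDiff ℝ 5 f) (hb : ∀ y : ℝ, |iteratedDeriv 5 f y| ≤ K) :
    ∀ x : ℝ, ∀ h : ℝ, 0 < h →
      |(f (x + h) - f (x - h)) / (2 * h)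
          - h ^ 2 / 6 *
            ((f (x + 2 * h) - 2 * f (x + h) + 2 * f (x - h) - f (x - 2 * h)) / (2 * h ^ 3))
          - deriv f x| ≤ K * h ^ 4 := by
  intro x h hh
  have hT := fun t ht => abs_sub_sum_iteratedDeriv_le (n := 4)
    (by norm_num; exact hf) hb x (t := t) ht
  have h1 := hT h hh.ne'
  have h2 := hT (-h) (by linarith)
  have h3 := hT (2 * h) (by positivity)
  have h4 := hT (-(2 * h)) (by linarith)
  simp only [Finset.sum_range_succ, Finset.sum_range_zero, iteratedDeriv_one, abs_neg,
    abs_of_pos hh, abs_of_pos (show 0 < 2 * h by positivity), ← sub_eq_add_neg,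
    Nat.factorial, abs_le] at h1 h2 h3 h4
  norm_num at h1 h2 h3 h4
  ring_nf at h1 h2 h3 h4
  have hK5 : 0 ≤ K * h ^ 5 := by positivity
  have key : (f (x + h) - f (x - h)) / (2 * h)
      - h ^ 2 / 6 *
        ((f (x + 2 * h) - 2 * f (x + h) + 2 * f (x - h) - f (x - 2 * h)) / (2 * h ^ 3))
      - deriv f x =
      (8 * f (x + h) - 8 * f (x - h) - f (x + 2 * h) + f (x - 2 * h)
        - 12 * (h * deriv f x)) / (12 * h) := by
    field_simp
    ring
  rw [key, abs_div, abs_of_pos (show 0 < 12 * h by positivity),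
    div_le_iff₀ (by positivity), abs_le]
  ring_nf
  constructor <;> linarith [h1.1, h1.2, h2.1, h2.2, h3.1, h3.2, h4.1, h4.2]
end
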